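/- Let d ≥ 3. For all x, y in the discrete orthant O = ℕ₀^d (nearest-neighbor edges, unit conductances), the Green's function of the simple random walk on O satisfies G_O(x, y) = Σ_{v ∈ {0,1}^d} g( x, ((−1)^{v_i}(y_i + 1/2) − 1/2)_{i=1}^d ), where for each v the point has i-th coordinate y_i if v_i = 0 and −y_i − 1 if v_i = 1, and g is the Green's function of the simple random walk on ℤ^d. In other words, G_O(x,y) is the sum of g(x, z) over all 2^d reflections z of y about the hyperplanes {x ∈ ℝ^d : x_j = −1/2}, j = 1, …, d. -/

import Mathlib

open scoped ENNReal
open Filter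

noncomputable section

variable {V : Type*}

/-- Total conductance (weight) `π(x) = Σ_y c(x,y)` at a vertex `x`. -/
def piW (c : V → V → ℝ≥0∞) (x : V) : ℝ≥0∞ := ∑' y, c x y

/-- One-step transition probability `c(x,y)/π(x)` of the random walk with conductances `c`. -/
def step (c : V → V → ℝ≥0∞) (x y : V) : ℝ≥0∞ := c x y / piW c x

/-- `n`-step transition probability of the random walk with conductances `c`. -/
def stepN [DecidableEq V] (c : V → V → ℝ≥0∞) : ℕ → V → V → ℝ≥0∞
  | 0, x, y => if x = y then 1 else 0
  | n + 1, x, y => ∑' z, stepN c n x z * step c z y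

/-- Green's function `G(x,y) = π(y)⁻¹ Σ_n p_n(x,y)` of the walk with conductances `c`. -/
def green [DecidableEq V] (c : V → V → ℝ≥0∞) (x y : V) : ℝ≥0∞ :=
  (piW c y)⁻¹ * ∑' n, stepN c n x y

/-- Nearest-neighbour adjacency on `ℤ^d`. -/
def latAdj {d : ℕ} (x y : Fin d → ℤ) : Prop := (∑ i, (x i - y i).natAbs) = 1

instance {d : ℕ} (x y : Fin d → ℤ) : Decidable (latAdj x y) := by
  unfold latAdj; infer_instance

/-- Unit conductances on `ℤ^d`. -/
def cZ (d : ℕ) (x y : Fin d → ℤ) : ℝ≥0∞ := if latAdj x y then 1 else 0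

/-- Green's function of the simple random walk on `ℤ^d`. -/
def g (d : ℕ) : (Fin d → ℤ) → (Fin d → ℤ) → ℝ≥0∞ := green (cZ d)

/-- Membership in `U_m = ℕ₀^m × ℤ^{d-m}`: the first `m` coordinates are nonnegative. -/
def memU (m : ℕ) {d : ℕ} (x : Fin d → ℤ) : Prop := ∀ i : Fin d, (i : ℕ) < m → 0 ≤ x i

instance (m : ℕ) {d : ℕ} (x : Fin d → ℤ) : Decidable (memU m x) := by
  unfold memU; infer_instance

/-- Unit conductances on the subgraph `U_m` of `ℤ^d`. -/
def cU (d m : ℕ) (x y : Fin d → ℤ) : ℝ≥0∞ :=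
  if memU m x ∧ memU m y ∧ latAdj x y then 1 else 0

/-- Green's function `G_m` of the simple random walk on `U_m = ℕ₀^m × ℤ^{d-m}`. -/
def Gm (d m : ℕ) : (Fin d → ℤ) → (Fin d → ℤ) → ℝ≥0∞ := green (cU d m)

/-- Reflection in the first coordinate: `ȳ = (-y₁, y₂, …, y_d)`. -/
def reflFirst {d : ℕ} (y : Fin d → ℤ) : Fin d → ℤ := fun i => if (i : ℕ) = 0 then -y i else y i

/-- The first standard basis vector of `ℤ^d`. -/
def e1 (d : ℕ) : Fin d → ℤ := fun i => if (i : ℕ) = 0 then 1 else 0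


/-- The Green's function truncated to the first `N` steps. -/
def greenN [DecidableEq V] (c : V → V → ℝ≥0∞) (N : ℕ) (x y : V) : ℝ≥0∞ :=
  (piW c y)⁻¹ * ∑ n ∈ Finset.range N, stepN c n x y

theorem green_eq_iSup_greenN [DecidableEq V] (c : V → V → ℝ≥0∞) (x y : V) :
    green c x y = ⨆ N, greenN c N x y := by
  simp only [green, greenN, ENNReal.tsum_eq_iSup_nat, ENNReal.mul_iSup]

theorem greenN_mono [DecidableEq V] (c : V → V → ℝ≥0∞) (x y : V) :
    Monotone fun N => greenN c N x y := by
  intro M N h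
  exact mul_le_mul_right (Finset.sum_le_sum_of_subset (Finset.range_mono h)) _

theorem piW_mul_greenN_succ [DecidableEq V] (c : V → V → ℝ≥0∞) (N : ℕ) (x y : V)
    (h0 : piW c y ≠ 0) (h1 : piW c y ≠ ⊤) :
    piW c y * greenN c (N + 1) x y
      = (if x = y then 1 else 0) + ∑' z, greenN c N x z * c z y := by
  rw [greenN, ENNReal.mul_inv_cancel_left h0 h1, Finset.sum_range_succ', add_comm]
  congr 1
  simp only [stepN]
  rw [← Summable.tsum_finsetSum fun _ _ => ENNReal.summable]
  refine tsum_congr fun z => ?_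
  rw [← Finset.sum_mul, greenN, step, div_eq_mul_inv]
  ring

theorem piW_mul_green [DecidableEq V] (c : V → V → ℝ≥0∞) (x y : V)
    (h0 : piW c y ≠ 0) (h1 : piW c y ≠ ⊤) :
    piW c y * green c x y = (if x = y then 1 else 0) + ∑' z, green c x z * c z y := by
  rw [green, ENNReal.mul_inv_cancel_left h0 h1,
    tsum_eq_zero_add' (f := fun n => stepN c n x y) ENNReal.summable]
  congr 1
  simp only [stepN]
  rw [ENNReal.tsum_comm]
  refine tsum_congr fun z => ?_
  rw [ENNReal.tsum_mul_right, green, step, div_eq_mul_inv]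
  ring

theorem latAdj_comm {d : ℕ} (x y : Fin d → ℤ) : latAdj x y ↔ latAdj y x := by
  unfold latAdj
  have h : ∀ i, (x i - y i).natAbs = (y i - x i).natAbs := fun i => by omega
  simp only [h]

theorem cZ_comm (d : ℕ) (x y : Fin d → ℤ) : cZ d x y = cZ d y x := by
  simp only [cZ, latAdj_comm x y]

theorem cU_comm (d m : ℕ) (x y : Fin d → ℤ) : cU d m x y = cU d m y x := by
  simp only [cU, latAdj_comm x y, and_left_comm]

/-- The neighbour of `y` obtained by moving one step in direction `± e_i`. -/
def nbr {d : ℕ} (y : Fin d → ℤ) (p : Fin d × Bool) : Fin d → ℤ :=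
  Function.update y p.1 (if p.2 then y p.1 + 1 else y p.1 - 1)

theorem nbr_injective {d : ℕ} (y : Fin d → ℤ) : Function.Injective (nbr y) := by
  rintro ⟨i, a⟩ ⟨j, b⟩ h
  have hi := congrFun h i
  have hij : i = j := by
    by_contra hij
    simp only [nbr, Function.update_self, Function.update_of_ne hij] at hi
    split_ifs at hi <;> omega
  subst hij
  simp only [nbr, Function.update_self] at hi
  cases a <;> cases b <;> simp at hi ⊢ <;> omega

theorem latAdj_nbr {d : ℕ} (y : Fin d → ℤ) (p : Fin d × Bool) : latAdj (nbr y p) y := by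
  obtain ⟨i, b⟩ := p
  unfold latAdj
  rw [Finset.sum_eq_single i]
  · cases b <;> simp [nbr]
  · intro j _ hj
    simp [nbr, hj]
  · simp

theorem exists_nbr_of_latAdj {d : ℕ} {z y : Fin d → ℤ} (h : latAdj z y) :
    ∃ p, nbr y p = z := by
  unfold latAdj at h
  obtain ⟨i, hi⟩ : ∃ i, (z i - y i).natAbs ≠ 0 := by
    by_contra! hc
    simp [hc] at h
  have hs := Finset.add_sum_erase Finset.univ (fun i => (z i - y i).natAbs) (Finset.mem_univ i)
  rw [h] at hs
  have hone : (z i - y i).natAbs = 1 := by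
    omega
  have hzero : ∑ j ∈ Finset.univ.erase i, (z j - y j).natAbs = 0 := by
    omega
  have hz : ∀ j, j ≠ i → z j = y j := by
    intro j hj
    have := (Finset.sum_eq_zero_iff.mp hzero) j (by simp [hj])
    omega
  refine ⟨(i, decide (z i = y i + 1)), funext fun j => ?_⟩
  by_cases hj : j = i
  · subst hj
    simp only [nbr, Function.update_self, decide_eq_true_eq]
    split_ifs <;> omega
  · simp [nbr, hj, hz j hj]

theorem tsum_mul_cZ {d : ℕ} (f : (Fin d → ℤ) → ℝ≥0∞) (y : Fin d → ℤ) :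
    ∑' z, f z * cZ d z y = ∑ i, (f (nbr y (i, true)) + f (nbr y (i, false))) := by
  rw [← (nbr_injective y).tsum_eq, tsum_fintype, Fintype.sum_prod_type]
  · simp [cZ, latAdj_nbr]
  · intro z hz
    by_contra hc
    apply hz
    have : ¬ latAdj z y := fun h => hc (exists_nbr_of_latAdj h)
    simp [cZ, this]

theorem piW_cZ (d : ℕ) (y : Fin d → ℤ) : piW (cZ d) y = 2 * d := by
  have h := tsum_mul_cZ (fun _ => 1) y
  simp only [one_mul] at h
  simp only [piW, cZ_comm d y, h]
  simp [mul_comm, one_add_one_eq_two]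

theorem memU_iff {d : ℕ} (y : Fin d → ℤ) : memU d y ↔ ∀ i, 0 ≤ y i := by
  simp [memU]

theorem memU_nbr_true {d : ℕ} {y : Fin d → ℤ} (hy : memU d y) (i : Fin d) :
    memU d (nbr y (i, true)) := by
  rw [memU_iff] at *
  intro j
  have := hy j
  by_cases hj : j = i
  · subst hj
    simp [nbr]
    omega
  · simpa [nbr, hj] using this

theorem memU_nbr_false {d : ℕ} {y : Fin d → ℤ} (hy : memU d y) (i : Fin d) :
    memU d (nbr y (i, false)) ↔ 0 < y i := by
  rw [memU_iff] at *
  constructor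
  · intro h
    have := h i
    simp [nbr] at this
    omega
  · intro h j
    have := hy j
    by_cases hj : j = i
    · subst hj
      simp [nbr]
      omega
    · simpa [nbr, hj] using this

theorem tsum_mul_cU {d : ℕ} (f : (Fin d → ℤ) → ℝ≥0∞) {y : Fin d → ℤ} (hy : memU d y) :
    ∑' z, f z * cU d d z y
      = ∑ i, (f (nbr y (i, true)) + if 0 < y i then f (nbr y (i, false)) else 0) := by
  have h := tsum_mul_cZ (fun z => if memU d z then f z else 0) y
  simp only [memU_nbr_true hy, memU_nbr_false hy, if_true] at h
  rw [← h]
  refine tsum_congr fun z => ?_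
  by_cases hz : memU d z <;> simp [cU, cZ, hy, hz]

/-- The number of vanishing coordinates of a point of the orthant. -/
def numZero {d : ℕ} (y : Fin d → ℤ) : ℝ≥0∞ := ∑ i, if 0 < y i then 0 else 1

theorem numZero_ne_top {d : ℕ} (y : Fin d → ℤ) : numZero y ≠ ⊤ := by
  refine ENNReal.sum_ne_top.mpr fun i _ => ?_
  split_ifs <;> simp

theorem tsum_mul_cZ_of_reflection {d : ℕ} (f : (Fin d → ℤ) → ℝ≥0∞) {y : Fin d → ℤ}
    (hy : memU d y) (hf : ∀ i, f (Function.update y i (-y i - 1)) = f y) :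
    ∑' z, f z * cZ d z y = ∑' z, f z * cU d d z y + numZero y * f y := by
  rw [tsum_mul_cZ, tsum_mul_cU f hy, numZero, Finset.sum_mul, ← Finset.sum_add_distrib]
  refine Finset.sum_congr rfl fun i _ => ?_
  rw [add_assoc]
  congr 1
  by_cases h : 0 < y i
  · simp [h]
  · have h0 : y i = 0 := le_antisymm (not_lt.mp h) ((memU_iff y).mp hy i)
    have := hf i
    simpa [h0, nbr] using this

theorem piW_cU_add_numZero {d : ℕ} {y : Fin d → ℤ} (hy : memU d y) :
    piW (cU d d) y + numZero y = 2 * d := by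
  have h := tsum_mul_cZ_of_reflection (fun _ => 1) hy (fun _ => rfl)
  simp only [one_mul, mul_one] at h
  rw [← piW_cZ d y, piW, piW]
  simp only [cZ_comm d y, cU_comm d d y, h]

theorem piW_cU_ne_top {d : ℕ} {y : Fin d → ℤ} (hy : memU d y) : piW (cU d d) y ≠ ⊤ := by
  have h : piW (cU d d) y ≤ 2 * d := piW_cU_add_numZero hy ▸ le_self_add
  exact ne_top_of_le_ne_top (ENNReal.mul_ne_top (by simp) (by simp)) h

theorem piW_cU_ne_zero {d : ℕ} (hd : 0 < d) {y : Fin d → ℤ} (hy : memU d y) :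
    piW (cU d d) y ≠ 0 := by
  intro h0
  have h : cU d d y (nbr y (⟨0, hd⟩, true)) = 0 := ENNReal.tsum_eq_zero.mp h0 _
  rw [cU_comm] at h
  simp [cU, hy, memU_nbr_true hy, latAdj_nbr] at h

/-- Reflection of `y` about the hyperplanes `{x_i = -1/2}` with `v i = true`. -/
def reflHalf {d : ℕ} (v : Fin d → Bool) (y : Fin d → ℤ) : Fin d → ℤ :=
  fun i => if v i then -y i - 1 else y i

theorem reflHalf_involutive {d : ℕ} (v : Fin d → Bool) : Function.Involutive (reflHalf v) := by
  intro y
  funext i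
  cases h : v i <;> simp [reflHalf, h]

theorem latAdj_reflHalf {d : ℕ} (v : Fin d → Bool) (z y : Fin d → ℤ) :
    latAdj (reflHalf v z) (reflHalf v y) ↔ latAdj z y := by
  unfold latAdj
  suffices ∀ i, (reflHalf v z i - reflHalf v y i).natAbs = (z i - y i).natAbs by
    simp only [this]
  intro i
  cases h : v i <;> simp [reflHalf, h]
  omega

theorem reflHalf_update {d : ℕ} (v : Fin d → Bool) (y : Fin d → ℤ) (i : Fin d) :
    reflHalf v (Function.update y i (-y i - 1)) = reflHalf (Function.update v i (!v i)) y := by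
  funext j
  by_cases hj : j = i
  · subst hj
    cases h : v j <;> simp [reflHalf, h]
  · simp [reflHalf, hj]

/-- The sum of a function over all reflections of a point. -/
def reflSum {d : ℕ} (u : (Fin d → ℤ) → ℝ≥0∞) (y : Fin d → ℤ) : ℝ≥0∞ :=
  ∑ v : Fin d → Bool, u (reflHalf v y)

theorem reflSum_update {d : ℕ} (u : (Fin d → ℤ) → ℝ≥0∞) (y : Fin d → ℤ) (i : Fin d) :
    reflSum u (Function.update y i (-y i - 1)) = reflSum u y := by
  have hinv : Function.Involutive fun v : Fin d → Bool => Function.update v i (!v i) := by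
    intro v
    funext j
    by_cases hj : j = i
    · subst hj
      simp
    · simp [hj]
  unfold reflSum
  rw [Finset.sum_congr rfl fun v _ => congrArg u (reflHalf_update v y i)]
  exact Equiv.sum_comp hinv.toPerm fun v => u (reflHalf v y)

theorem reflSum_tsum_mul_cZ {d : ℕ} (u : (Fin d → ℤ) → ℝ≥0∞) (y : Fin d → ℤ) :
    reflSum (fun w => ∑' z, u z * cZ d z w) y = ∑' z, reflSum u z * cZ d z y := by
  simp only [reflSum, Finset.sum_mul]
  rw [Summable.tsum_finsetSum fun _ _ => ENNReal.summable]
  refine Finset.sum_congr rfl fun v _ => ?_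
  rw [← (reflHalf_involutive v).toPerm.tsum_eq]
  refine tsum_congr fun z => ?_
  simp [cZ, latAdj_reflHalf]

theorem reflSum_delta {d : ℕ} {x y : Fin d → ℤ} (hx : memU d x) (hy : memU d y) :
    reflSum (fun w => if x = w then 1 else 0) y = if x = y then 1 else 0 := by
  rw [memU_iff] at hx hy
  rw [reflSum, Finset.sum_eq_single fun _ => false]
  · have h : reflHalf (fun _ => false) y = y := funext fun i => by simp [reflHalf]
    rw [h]
  · intro v _ hv
    obtain ⟨i, hi⟩ := Function.ne_iff.mp hv
    have hi : v i = true := by simpa using hi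
    refine if_neg fun h => ?_
    have h1 := congrFun h i
    simp only [reflHalf, hi, if_true] at h1
    have := hx i
    have := hy i
    omega
  · simp

/-- Summing a Poisson-type recursion on `ℤ^d` over reflections yields one on the orthant. -/
theorem reflSum_recursion {d : ℕ} {x y : Fin d → ℤ} (hx : memU d x) (hy : memU d y)
    (u w : (Fin d → ℤ) → ℝ≥0∞)
    (h : ∀ y, 2 * d * w y = (if x = y then 1 else 0) + ∑' z, u z * cZ d z y) :
    2 * d * reflSum w y = (if x = y then 1 else 0) + ∑' z, reflSum u z * cU d d z y
      + numZero y * reflSum u y := by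
  rw [add_assoc, ← tsum_mul_cZ_of_reflection _ hy (reflSum_update u y),
    ← reflSum_tsum_mul_cZ, ← reflSum_delta hx hy]
  simp only [reflSum, Finset.mul_sum, h, Finset.sum_add_distrib]

theorem tsum_mul_cU_mono {d : ℕ} {u w : (Fin d → ℤ) → ℝ≥0∞}
    (h : ∀ z, memU d z → u z ≤ w z) (y : Fin d → ℤ) :
    ∑' z, u z * cU d d z y ≤ ∑' z, w z * cU d d z y := by
  refine ENNReal.tsum_le_tsum fun z => ?_
  by_cases hz : memU d z
  · exact mul_le_mul_left (h z hz) _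
  · simp [cU, hz]

theorem reflSum_greenN_le {d : ℕ} (hd : 0 < d) {x : Fin d → ℤ} (hx : memU d x) (N : ℕ) :
    ∀ y, memU d y → reflSum (greenN (cZ d) N x) y ≤ Gm d d x y := by
  have h2d : (2 * d : ℝ≥0∞) ≠ 0 := by simp [hd.ne']
  have h2t : (2 * d : ℝ≥0∞) ≠ ⊤ := ENNReal.mul_ne_top (by simp) (by simp)
  induction N with
  | zero => simp [reflSum, greenN]
  | succ N ih =>
    intro y hy
    rw [← ENNReal.mul_le_mul_iff_right h2d h2t, reflSum_recursion hx hy (greenN (cZ d) N x)]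
    · rw [← piW_cU_add_numZero hy, add_mul, Gm,
        piW_mul_green _ x y (piW_cU_ne_zero hd hy) (piW_cU_ne_top hy)]
      exact add_le_add (add_le_add le_rfl (tsum_mul_cU_mono ih y))
        (mul_le_mul_right (ih y hy) _)
    · intro y
      rw [← piW_cZ d y] at h2d h2t ⊢
      exact piW_mul_greenN_succ _ N x y h2d h2t

theorem piW_mul_reflSum_ge {d : ℕ} (hd : 0 < d) {x y : Fin d → ℤ} (hx : memU d x)
    (hy : memU d y) :
    (if x = y then 1 else 0) + ∑' z, reflSum (g d x) z * cU d d z y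
      ≤ piW (cU d d) y * reflSum (g d x) y := by
  have h2d : (2 * d : ℝ≥0∞) ≠ 0 := by simp [hd.ne']
  have h2t : (2 * d : ℝ≥0∞) ≠ ⊤ := ENNReal.mul_ne_top (by simp) (by simp)
  by_cases htop : reflSum (g d x) y = ⊤
  · simp [htop, ENNReal.mul_top (piW_cU_ne_zero hd hy)]
  have h := reflSum_recursion hx hy (g d x) (g d x) fun y => by
    rw [← piW_cZ d y] at h2d h2t ⊢
    exact piW_mul_green _ x y h2d h2t
  rw [← piW_cU_add_numZero hy, add_mul] at h
  exact (ENNReal.add_left_inj (ENNReal.mul_ne_top (numZero_ne_top y) htop)).mp h |>.ge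

theorem greenN_cU_le {d : ℕ} (hd : 0 < d) {x : Fin d → ℤ} (hx : memU d x) (N : ℕ) :
    ∀ y, memU d y → greenN (cU d d) N x y ≤ reflSum (g d x) y := by
  induction N with
  | zero => simp [greenN]
  | succ N ih =>
    intro y hy
    have h0 := piW_cU_ne_zero hd hy
    have h1 := piW_cU_ne_top hy
    rw [← ENNReal.mul_le_mul_iff_right h0 h1, piW_mul_greenN_succ _ N x y h0 h1]
    refine le_trans ?_ (piW_mul_reflSum_ge hd hx hy)
    exact add_le_add le_rfl (tsum_mul_cU_mono ih y)

/-- **Green's function on the orthant `O = ℕ₀^d`.** For `d ≥ 3` and `x, y ∈ O`,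
`G_O(x,y) = Σ_{v ∈ {0,1}^d} g(x, z_v)` where the `i`-th coordinate of `z_v` is `y_i`
if `v_i = 0` and `-y_i - 1` if `v_i = 1`; i.e. `G_O(x,y)` is the sum of `g(x,z)` over
all `2^d` reflections `z` of `y` about the hyperplanes `{x_j = -1/2}`. -/
theorem green_orthant (d : ℕ) (hd : 3 ≤ d) (x y : Fin d → ℤ)
    (hx : memU d x) (hy : memU d y) :
    Gm d d x y
      = ∑ v : Fin d → Bool, g d x (fun i => if v i then -y i - 1 else y i) := by
  have hd0 : 0 < d := by omega
  change _ = reflSum (g d x) y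
  apply le_antisymm
  · rw [Gm, green_eq_iSup_greenN]
    exact iSup_le fun N => greenN_cU_le hd0 hx N y hy
  · have h : reflSum (g d x) y = ⨆ N, reflSum (greenN (cZ d) N x) y := by
      simp only [reflSum, g, green_eq_iSup_greenN]
      exact ENNReal.finsetSum_iSup_of_monotone fun v => greenN_mono _ _ _
    rw [h]
    exact iSup_le fun N => reflSum_greenN_le hd0 hx N y hy

end
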